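/- Let B be a unital C*-algebra, X a closed linear subspace of B, and z ∈ B with ‖z‖ ≤ 1 such that x·z·y ∈ X for all x, y ∈ X. Then there exists a linear map σ : X → M₂(B) such that σ(x·z·y) = σ(x)·σ(y) for all x, y ∈ X, and σ is a complete isometry: for every n ∈ ℕ and every n×n matrix (x_{ij}) with entries in X, ‖(σ(x_{ij}))_{ij}‖ (computed in Mₙ(M₂(B))) equals ‖(x_{ij})‖ (computed in Mₙ(B)). In particular, X equipped with the product (x, y) ↦ x·z·y is completely isometrically representable as an algebra of operators, namely as a subalgebra of the C*-algebra M₂(B). -/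

import Mathlib

open scoped Matrix

/-- The unique C*-algebra norm on `n × n` matrices over a (unital) C*-algebra `B`,
given by the purely algebraic-analytic formula `‖M‖ = √(spectralRadius (Mᴴ * M))`,
which is the unique C*-norm since `Mₙ(B)` is a C*-algebra and in any C*-algebra
`‖a‖² = ‖a⋆a‖ = r(a⋆a)`. -/
noncomputable def cstarMatrixNorm {B : Type*} [Ring B] [StarRing B] [Algebra ℂ B]
    {n : ℕ} (M : Matrix (Fin n) (Fin n) B) : ℝ :=
  Real.sqrt ((spectralRadius ℂ (star M * M)).toReal)

theorem exists_isSelfAdjoint_mul_star_add_mul_self_eq_one {B : Type*} [CStarAlgebra B] {z : B}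
    (hz : ‖z‖ ≤ 1) : ∃ d : B, star d = d ∧ z * star z + d * d = 1 := by
  let _ : PartialOrder B := CStarAlgebra.spectralOrder B
  have _ : StarOrderedRing B := CStarAlgebra.spectralOrderedRing B
  have hle : z * star z ≤ 1 := by
    rw [← CStarAlgebra.norm_le_one_iff_of_nonneg _ (mul_star_self_nonneg z),
      CStarRing.norm_self_mul_star]
    exact mul_le_one₀ hz (norm_nonneg z) hz
  refine ⟨CFC.sqrt (1 - z * star z), (CFC.sqrt_nonneg _).isSelfAdjoint, ?_⟩
  rw [CFC.sqrt_mul_sqrt_self _ (sub_nonneg.2 hle), add_sub_cancel]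

theorem spectralRadius_eq_of_forall_ne_zero {R S : Type*} [Ring R] [Algebra ℂ R] [Ring S]
    [Algebra ℂ S] {a : R} {b : S}
    (h : ∀ k : ℂ, k ≠ 0 → (k ∈ spectrum ℂ a ↔ k ∈ spectrum ℂ b)) :
    spectralRadius ℂ a = spectralRadius ℂ b := by
  refine iSup_congr fun k ↦ ?_
  rcases eq_or_ne k 0 with rfl | hk
  · simp
  · rw [h k hk]

theorem spectralRadius_mul_comm {R : Type*} [Ring R] [Algebra ℂ R] (a b : R) :
    spectralRadius ℂ (a * b) = spectralRadius ℂ (b * a) :=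
  spectralRadius_eq_of_forall_ne_zero fun _ hk ↦
    spectrum.unit_mem_mul_comm (r := Units.mk0 _ hk)

/-- A corner embedding `φ` with compression `ψ` preserves the spectral radius. -/
theorem spectralRadius_corner {R S : Type*} [Ring R] [Algebra ℂ R] [Ring S] [Algebra ℂ S]
    (φ : R →ₗ[ℂ] S) (ψ : S →ₗ[ℂ] R) (hφ : ∀ a b, φ (a * b) = φ a * φ b) (hψ : ψ 1 = 1)
    (hl : ∀ a s, ψ (φ a * s) = a * ψ s) (hr : ∀ s a, ψ (s * φ a) = ψ s * a) (a : R) :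
    spectralRadius ℂ (φ a) = spectralRadius ℂ a := by
  refine spectralRadius_eq_of_forall_ne_zero fun k hk ↦ ?_
  rw [spectrum.mem_iff, spectrum.mem_iff, not_iff_not, Algebra.algebraMap_eq_smul_one,
    Algebra.algebraMap_eq_smul_one]
  constructor
  · rintro ⟨⟨u, v, huv, hvu⟩, rfl : u = _⟩
    refine ⟨⟨_, ψ v, ?_, ?_⟩, rfl⟩
    · have := congrArg ψ huv
      simpa [sub_mul, hl, hψ] using this
    · have := congrArg ψ hvu
      simpa [mul_sub, hr, hψ] using this
  · rintro ⟨⟨u, v, huv, hvu⟩, rfl : u = _⟩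
    have h₁ : (k • 1 - φ a) * φ v = φ 1 := by
      rw [← huv, hφ, map_sub, map_smul, sub_mul, sub_mul, smul_mul_assoc, smul_mul_assoc, one_mul,
        ← hφ 1, one_mul]
    have h₂ : φ v * (k • 1 - φ a) = φ 1 := by
      rw [← hvu, hφ, map_sub, map_smul, mul_sub, mul_sub, mul_smul_comm, mul_smul_comm, mul_one,
        ← hφ v 1, mul_one]
    have h₃ : (k • 1 - φ a) * (1 - φ 1) = k • (1 - φ 1) := by
      simp [sub_mul, mul_sub, ← hφ, smul_sub]
    have h₄ : (1 - φ 1) * (k • 1 - φ a) = k • (1 - φ 1) := by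
      simp [sub_mul, mul_sub, ← hφ, smul_sub]
    refine ⟨⟨_, φ v + k⁻¹ • (1 - φ 1), ?_, ?_⟩, rfl⟩
    · rw [mul_add, h₁, mul_smul_comm, h₃, inv_smul_smul₀ hk, add_sub_cancel]
    · rw [add_mul, h₂, smul_mul_assoc, h₄, inv_smul_smul₀ hk, add_sub_cancel]

/-- The spectral radius is unchanged by the upper left corner embedding `Mₙ(B) → Mₙ(M₂(B))`. -/
theorem spectralRadius_map_single {B : Type*} [Ring B] [Algebra ℂ B] {n : ℕ}
    (A : Matrix (Fin n) (Fin n) B) :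
    spectralRadius ℂ (A.map (Matrix.single (0 : Fin 2) (0 : Fin 2))) = spectralRadius ℂ A := by
  let φ : Matrix (Fin n) (Fin n) B →ₗ[ℂ] Matrix (Fin n) (Fin n) (Matrix (Fin 2) (Fin 2) B) :=
    (Matrix.singleLinearMap ℂ 0 0).mapMatrix
  let ψ : Matrix (Fin n) (Fin n) (Matrix (Fin 2) (Fin 2) B) →ₗ[ℂ] Matrix (Fin n) (Fin n) B :=
    (Matrix.entryLinearMap ℂ B 0 0).mapMatrix
  have hφ (a : Matrix (Fin n) (Fin n) B) (i j : Fin n) : φ a i j = Matrix.single 0 0 (a i j) := rfl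
  have hψ (s : Matrix (Fin n) (Fin n) (Matrix (Fin 2) (Fin 2) B)) (i j : Fin n) :
      ψ s i j = s i j 0 0 := rfl
  refine spectralRadius_corner φ ψ (fun a b ↦ ?_) ?_ (fun a s ↦ ?_) (fun s a ↦ ?_) A
  · ext1 i j
    simp only [hφ, Matrix.mul_apply, Matrix.single_mul_single_same]
    simp only [← Matrix.singleAddMonoidHom_apply, map_sum]
  · ext i j
    by_cases h : i = j <;> simp [hψ, Matrix.one_apply, h]
  · ext i j
    simp [hφ, hψ, Matrix.mul_apply, Matrix.sum_apply]
  · ext i j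
    simp [hφ, hψ, Matrix.mul_apply, Matrix.sum_apply]

/-- Let `B` be a unital C*-algebra, `X ⊆ B` a closed linear subspace and `z ∈ B` with
`‖z‖ ≤ 1` such that `x·z·y ∈ X` for all `x, y ∈ X`.  Then there is a linear map
`σ : X → M₂(B)` which is multiplicative from the product `(x, y) ↦ x·z·y` to the
product of `M₂(B)`, and which is a complete isometry:  the norm of `(σ(x_{ij}))` in
`Mₙ(M₂(B))` equals the norm of `(x_{ij})` in `Mₙ(B)` for every square matrix over
`X`.  In particular `(X, (x, y) ↦ x·z·y)` is completely isometrically representable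
as a subalgebra of the C*-algebra `M₂(B)`. -/
theorem stmt2 {B : Type*} [CStarAlgebra B]
    (X : Submodule ℂ B) (hXc : IsClosed (X : Set B))
    (z : B) (hz : ‖z‖ ≤ 1)
    (hXzX : ∀ x ∈ X, ∀ y ∈ X, x * z * y ∈ X) :
    ∃ σ : X →ₗ[ℂ] Matrix (Fin 2) (Fin 2) B,
      (∀ x y : X, σ ⟨(x : B) * z * (y : B), hXzX x x.2 y y.2⟩ = σ x * σ y) ∧
      (∀ (n : ℕ) (M : Matrix (Fin n) (Fin n) X),
        cstarMatrixNorm (M.map σ) = cstarMatrixNorm (M.map (fun x => (x : B)))) := by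
  obtain ⟨d, hd, hzd⟩ := exists_isSelfAdjoint_mul_star_add_mul_self_eq_one hz
  let σ : X →ₗ[ℂ] Matrix (Fin 2) (Fin 2) B :=
    { toFun x := !![(x : B) * z, (x : B) * d; 0, 0]
      map_add' x y := by simp [add_mul]
      map_smul' c x := by simp }
  have hσ (x y : X) : σ x * star (σ y) = Matrix.single 0 0 ((x : B) * star (y : B)) := by
    have h : (x : B) * z * (star z * star (y : B)) + (x : B) * d * (d * star (y : B))
        = x * star (y : B) := by
      calc _ = (x : B) * (z * star z + d * d) * star (y : B) := by noncomm_ring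
        _ = _ := by rw [hzd, mul_one]
    ext i j
    fin_cases i <;> fin_cases j <;>
      simp [σ, Matrix.mul_apply, hd, h]
  refine ⟨σ, fun x y ↦ ?_, fun n M ↦ ?_⟩
  · ext i j
    fin_cases i <;> fin_cases j <;> simp [σ, mul_assoc]
  · have h : M.map σ * star (M.map σ) =
        (M.map (fun x ↦ (x : B)) * star (M.map fun x ↦ (x : B))).map (Matrix.single 0 0) := by
      ext1 i j
      simp only [Matrix.mul_apply, Matrix.star_apply, Matrix.map_apply, hσ,
        ← Matrix.singleAddMonoidHom_apply, map_sum]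
    rw [cstarMatrixNorm, cstarMatrixNorm, spectralRadius_mul_comm, h, spectralRadius_map_single,
      spectralRadius_mul_comm]
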